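/- Let V : ℝ → ℝ be bounded and continuous and a > 0. Suppose E₀ < E₁ < ⋯ < Eₙ are Dirichlet eigenvalues of −d²/dx² + V on [0,a] and that every Dirichlet eigenvalue E with E ≤ Eₙ equals one of E₀,…,Eₙ (i.e., these are the n+1 lowest Dirichlet eigenvalues). Then the solution u(·,Eₙ) with u(0,Eₙ) = 0, u′(0,Eₙ) = 1 has exactly n zeros in the open interval (0,a). -/

import Mathlib

open Set

/-- `E` is a Dirichlet eigenvalue of `−d²/dx² + V` on `[0,a]`: there is a not-identically-zero
solution of `−u″ + Vu = Eu` on `[0,a]` with `u(0) = u(a) = 0`. -/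
def IsDirichletEigenvalue (V : ℝ → ℝ) (a E : ℝ) : Prop :=
  ∃ u : ℝ → ℝ, ContDiff ℝ 2 u ∧
    (∀ x ∈ Set.Icc 0 a, deriv (deriv u) x = (V x - E) * u x) ∧
    (∃ x ∈ Set.Icc 0 a, u x ≠ 0) ∧ u 0 = 0 ∧ u a = 0

open Topology NNReal

/-- A time-dependent vector field on a Banach space which is continuous in time, bounded and
Lipschitz in space has a global integral curve through any given point at time zero. -/
theorem exists_forall_hasDerivAt_of_lipschitzWith_of_norm_le {F : Type*} [NormedAddCommGroup F]
    [NormedSpace ℝ F] [CompleteSpace F] {v : ℝ → F → F} {K L : ℝ≥0}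
    (hc : ∀ y, Continuous fun t => v t y) (hK : ∀ t, LipschitzWith K (v t))
    (hL : ∀ t y, ‖v t y‖ ≤ L) (y₀ : F) :
    ∃ γ : ℝ → F, γ 0 = y₀ ∧ ∀ t, HasDerivAt γ (v t (γ t)) t := by
  have local_sol (N : ℕ) : ∃ γ : ℝ → F, γ 0 = y₀ ∧
      ∀ t ∈ Ioo (-(N : ℝ)) N, HasDerivAt γ (v t (γ t)) t := by
    have hN : (0 : ℝ) ∈ Icc (-(N : ℝ)) N := by simp
    have hP : IsPicardLindelof v (⟨0, hN⟩ : Icc (-(N : ℝ)) N) y₀ (L * N) 0 L K :=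
      { lipschitzOnWith := fun t _ => (hK t).lipschitzOnWith
        continuousOn := fun y _ => (hc y).continuousOn
        norm_le := fun t _ y _ => hL t y
        mul_max_le := by simp }
    obtain ⟨γ, hγ0, hγ⟩ := hP.exists_eq_forall_mem_Icc_hasDerivWithinAt₀
    exact ⟨γ, hγ0, fun t ht =>
      (hγ t (Ioo_subset_Icc_self ht)).hasDerivAt (Icc_mem_nhds ht.1 ht.2)⟩
  choose γ hγ0 hγ using local_sol
  have agree {m n : ℕ} (hmn : m ≤ n) {t : ℝ} (ht : t ∈ Ioo (-(m : ℝ)) m) : γ m t = γ n t := by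
    have hm : (0 : ℝ) < m := by linarith [ht.1, ht.2]
    have hmn' : (m : ℝ) ≤ n := by exact_mod_cast hmn
    refine ODE_solution_unique_of_mem_Ioo (v := v) (K := K) (s := fun _ => univ) (t₀ := 0)
      (fun t _ => (hK t).lipschitzOnWith) ⟨by linarith, hm⟩ (fun t ht => ⟨hγ m t ht, trivial⟩)
      (fun t ht => ⟨hγ n t ⟨by linarith [ht.1], by linarith [ht.2]⟩, trivial⟩) ?_ ht
    rw [hγ0, hγ0]
  have index_mem (t : ℝ) : t ∈ Ioo (-((⌈|t|⌉₊ + 1 : ℕ) : ℝ)) (⌈|t|⌉₊ + 1 : ℕ) := by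
    have h := Nat.le_ceil |t|
    push_cast
    constructor <;> linarith [neg_abs_le t, le_abs_self t]
  have eq_of_mem {N : ℕ} {t : ℝ} (ht : t ∈ Ioo (-(N : ℝ)) N) : γ (⌈|t|⌉₊ + 1) t = γ N t := by
    rcases le_total N (⌈|t|⌉₊ + 1) with h | h
    · exact (agree h ht).symm
    · exact agree h (index_mem t)
  refine ⟨fun t => γ (⌈|t|⌉₊ + 1) t, hγ0 _, fun t => ?_⟩
  refine (hγ _ t (index_mem t)).congr_of_eventuallyEq ?_
  filter_upwards [isOpen_Ioo.mem_nhds (index_mem t)] with s hs using eq_of_mem hs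

/-- If a function is nonnegative at a point and has positive derivative at each of its zeros, then
it is positive to the right of that point. -/
theorem pos_of_deriv_pos_of_eq_zero {g g' : ℝ → ℝ} (hg : ∀ x, HasDerivAt g (g' x) x)
    (hpos : ∀ x, g x = 0 → 0 < g' x) {x y : ℝ} (hx : 0 ≤ g x) (hxy : x < y) : 0 < g y := by
  have hc : Continuous g := continuous_iff_continuousAt.2 fun t => (hg t).continuousAt
  have nonneg : ∀ ⦃t⦄, t ∈ Icc x y → 0 ≤ g t :=
    image_le_of_deriv_right_lt_deriv_boundary' (f := fun _ => 0) (f' := fun _ => 0)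
      continuousOn_const (fun t _ => hasDerivWithinAt_const ..) hx hc.continuousOn
      (fun t _ => (hg t).hasDerivWithinAt) (fun t _ ht => hpos t ht.symm)
  refine (nonneg ⟨hxy.le, le_rfl⟩).lt_of_ne fun h0 => ?_
  have hle : g' y ≤ 0 := by
    refine le_of_tendsto ((hasDerivWithinAt_iff_tendsto_slope' self_notMem_Iio).1
      (hg y).hasDerivWithinAt) ?_
    filter_upwards [Ioo_mem_nhdsLT hxy] with z hz
    rw [slope_def_field, ← h0, sub_zero]
    exact div_nonpos_of_nonneg_of_nonpos (nonneg ⟨hz.1.le, hz.2.le⟩) (sub_nonpos.2 hz.2.le)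
  exact absurd (hpos y h0.symm) hle.not_gt

theorem Real.sin_sq_sub_sin_sq (α β : ℝ) :
    Real.sin α ^ 2 - Real.sin β ^ 2 = Real.sin (α - β) * Real.sin (α + β) := by
  rw [Real.sin_sub, Real.sin_add]
  linear_combination Real.sin β ^ 2 * Real.sin_sq_add_cos_sq α -
    Real.sin α ^ 2 * Real.sin_sq_add_cos_sq β

/-- `θ` is the Prüfer angle, vanishing at `0`, of the equation `−u″ + Vu = Eu`. -/
structure IsPruferAngle (V : ℝ → ℝ) (E : ℝ) (θ : ℝ → ℝ) : Prop where
  map_zero : θ 0 = 0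
  hasDerivAt : ∀ x, HasDerivAt θ (1 + (E - V x - 1) * Real.sin (θ x) ^ 2) x

theorem exists_isPruferAngle {V : ℝ → ℝ} (hVb : ∃ M, ∀ x, |V x| ≤ M) (hVc : Continuous V)
    (E : ℝ) : ∃ θ, IsPruferAngle V E θ := by
  obtain ⟨M, hM⟩ := hVb
  have hM0 : 0 ≤ M := (abs_nonneg _).trans (hM 0)
  have hcoef (t : ℝ) : |E - V t - 1| ≤ |E| + M + 1 := by
    have h1 := abs_sub (E - V t) 1
    have h2 := abs_sub E (V t)
    rw [abs_one] at h1
    linarith [hM t]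
  obtain ⟨θ, h0, hθ⟩ := exists_forall_hasDerivAt_of_lipschitzWith_of_norm_le
    (v := fun t y => 1 + (E - V t - 1) * Real.sin y ^ 2)
    (K := ⟨|E| + M + 1, by positivity⟩) (L := ⟨1 + (|E| + M + 1), by positivity⟩)
    (fun y => by fun_prop)
    (fun t => LipschitzWith.of_dist_le_mul fun α β => by
      have h : |Real.sin α ^ 2 - Real.sin β ^ 2| ≤ |α - β| := by
        rw [Real.sin_sq_sub_sin_sq, abs_mul]
        calc _ ≤ |α - β| * 1 := mul_le_mul Real.abs_sin_le_abs (Real.abs_sin_le_one _)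
              (abs_nonneg _) (abs_nonneg _)
          _ = _ := mul_one _
      rw [Real.dist_eq, Real.dist_eq, add_sub_add_left_eq_sub, ← mul_sub, abs_mul]
      exact mul_le_mul (hcoef t) h (abs_nonneg _) ((abs_nonneg _).trans (hcoef t)))
    (fun t y => by
      refine (norm_add_le _ _).trans ?_
      rw [norm_one, Real.norm_eq_abs, abs_mul, abs_of_nonneg (sq_nonneg (Real.sin y))]
      have h := mul_le_mul (hcoef t) (Real.sin_sq_le_one y) (sq_nonneg _)
        ((abs_nonneg _).trans (hcoef t))
      rw [mul_one] at h
      exact add_le_add_right h 1)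
    0
  exact ⟨θ, h0, hθ⟩

namespace IsPruferAngle

variable {V : ℝ → ℝ} {E E' : ℝ} {θ θ' : ℝ → ℝ}

theorem continuous (h : IsPruferAngle V E θ) : Continuous θ :=
  continuous_iff_continuousAt.2 fun x => (h.hasDerivAt x).continuousAt

/-- A Prüfer angle crosses each integer multiple of `π` only upwards. -/
theorem int_mul_pi_lt (h : IsPruferAngle V E θ) (k : ℤ) {x y : ℝ} (hx : k * Real.pi ≤ θ x)
    (hxy : x < y) : k * Real.pi < θ y := by
  have := pos_of_deriv_pos_of_eq_zero (g := fun t => θ t - k * Real.pi)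
    (fun t => (h.hasDerivAt t).sub_const _)
    (fun t ht => by
      have : θ t = k * Real.pi := sub_eq_zero.1 ht
      simp [this]) (sub_nonneg.2 hx) hxy
  exact sub_pos.1 this

theorem pos (h : IsPruferAngle V E θ) {x : ℝ} (hx : 0 < x) : 0 < θ x := by
  simpa using h.int_mul_pi_lt 0 (x := 0) (by simp [h.map_zero]) hx

/-- Below the infimum of the potential the Prüfer angle does not reach `π / 2`. -/
theorem lt_pi_div_two (h : IsPruferAngle V E θ) (hE : ∀ x, E < V x) {x : ℝ} (hx : 0 < x) :
    θ x < Real.pi / 2 := by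
  have := pos_of_deriv_pos_of_eq_zero (g := fun t => Real.pi / 2 - θ t)
    (fun t => (h.hasDerivAt t).const_sub _)
    (fun t ht => by
      have : θ t = Real.pi / 2 := (sub_eq_zero.1 ht).symm
      simp [this, hE t]) (x := 0) (by rw [h.map_zero]; linarith [Real.pi_pos]) hx
  exact sub_pos.1 this

/-- The difference of two Prüfer angles satisfies a linear differential equation. -/
theorem hasDerivAt_sub (h : IsPruferAngle V E θ) (h' : IsPruferAngle V E' θ') (x : ℝ) :
    HasDerivAt (fun t => θ' t - θ t)
      ((E' - V x - 1) * Real.sinc (θ' x - θ x) * Real.sin (θ' x + θ x) * (θ' x - θ x) +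
        (E' - E) * Real.sin (θ x) ^ 2) x := by
  refine ((h'.hasDerivAt x).sub (h.hasDerivAt x)).congr_deriv ?_
  have hs : Real.sinc (θ' x - θ x) * (θ' x - θ x) = Real.sin (θ' x - θ x) := by
    rcases eq_or_ne (θ' x - θ x) 0 with h0 | h0
    · simp [h0]
    · rw [Real.sinc_of_ne_zero h0, div_mul_cancel₀ _ h0]
  linear_combination (E' - V x - 1) * Real.sin_sq_sub_sin_sq (θ' x) (θ x) -
    (E' - V x - 1) * Real.sin (θ' x + θ x) * hs

/-- The Prüfer angle is strictly increasing in the energy. -/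
theorem lt_of_lt (hVc : Continuous V) (h : IsPruferAngle V E θ) (h' : IsPruferAngle V E' θ')
    (hE : E < E') {a : ℝ} (ha : 0 < a) : θ a < θ' a := by
  have hθ := h.continuous
  have hθ' := h'.continuous
  set q : ℝ → ℝ := fun x => (E' - V x - 1) * Real.sinc (θ' x - θ x) * Real.sin (θ' x + θ x)
  have hq : Continuous q := by
    have := Real.continuous_sinc.comp (hθ'.sub hθ)
    simp only [Function.comp_def] at this
    fun_prop
  set Q : ℝ → ℝ := fun x => ∫ t in (0 : ℝ)..x, q t
  have hQ (x : ℝ) : HasDerivAt Q (q x) x := (hq.integral_hasStrictDerivAt 0 x).hasDerivAt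
  set G : ℝ → ℝ := fun x => (θ' x - θ x) * Real.exp (-Q x)
  have hG (x : ℝ) : HasDerivAt G ((E' - E) * Real.sin (θ x) ^ 2 * Real.exp (-Q x)) x := by
    refine ((h.hasDerivAt_sub h' x).mul (hQ x).neg.exp).congr_deriv ?_
    simp only [q, Pi.neg_apply]
    ring
  have hmono : Monotone G := monotone_of_hasDerivAt_nonneg hG fun x =>
    mul_nonneg (mul_nonneg (sub_nonneg.2 hE.le) (sq_nonneg _)) (Real.exp_pos _).le
  have hG0 : G 0 = 0 := by simp [G, h.map_zero, h'.map_zero]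
  obtain ⟨x, hx, hsin⟩ : ∃ x ∈ Ioo 0 a, Real.sin (θ x) ≠ 0 := by
    have hev : ∀ᶠ x in 𝓝[>] (0 : ℝ), θ x < Real.pi :=
      (hθ.continuousAt.eventually_lt continuousAt_const
        (by rw [h.map_zero]; exact Real.pi_pos)).filter_mono nhdsWithin_le_nhds
    obtain ⟨x, hx, hxa⟩ := (hev.and (Ioo_mem_nhdsGT ha)).exists
    exact ⟨x, hxa, (Real.sin_pos_of_pos_of_lt_pi (h.pos hxa.1) hx).ne'⟩
  have hGa : 0 < G a := by
    refine (hG0 ▸ hmono ha.le).lt_of_ne fun h0 => ?_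
    have hev : G =ᶠ[𝓝 x] fun _ => 0 := by
      filter_upwards [isOpen_Ioo.mem_nhds hx] with y hy
      exact le_antisymm (h0 ▸ hmono hy.2.le) (hG0 ▸ hmono hy.1.le)
    have := ((hasDerivAt_const x (0 : ℝ)).congr_of_eventuallyEq hev).unique (hG x)
    have : 0 < (E' - E) * Real.sin (θ x) ^ 2 * Real.exp (-Q x) :=
      mul_pos (mul_pos (sub_pos.2 hE) (by positivity)) (Real.exp_pos _)
    linarith
  exact sub_pos.1 (pos_of_mul_pos_left hGa (Real.exp_pos _).le)

/-- The Prüfer angle at a given point depends continuously on the energy. -/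
theorem continuous_energy (hVb : ∃ M, ∀ x, |V x| ≤ M) {Θ : ℝ → ℝ → ℝ}
    (hΘ : ∀ E, IsPruferAngle V E (Θ E)) {a : ℝ} (ha : 0 ≤ a) : Continuous fun E => Θ E a := by
  obtain ⟨M, hM⟩ := hVb
  refine continuous_iff_continuousAt.2 fun E => ?_
  have bound (E' : ℝ) :
      dist (Θ E' a) (Θ E a) ≤ gronwallBound 0 (|E| + M + 1) |E' - E| a := by
    have := norm_le_gronwallBound_of_norm_deriv_right_le (a := 0) (b := a) (δ := 0)
      (f := fun t => Θ E t - Θ E' t) (K := |E| + M + 1) (ε := |E' - E|)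
      ((hΘ E).continuous.sub (hΘ E').continuous).continuousOn
      (fun x _ => ((hΘ E').hasDerivAt_sub (hΘ E) x).hasDerivWithinAt)
      (by simp [(hΘ E).map_zero, (hΘ E').map_zero])
      (fun x _ => by
        have h1 := abs_sub (E - V x) 1
        have h2 := abs_sub E (V x)
        rw [abs_one] at h1
        have h3 : |E - V x - 1| ≤ |E| + M + 1 := by linarith [hM x]
        refine (norm_add_le _ _).trans (add_le_add ?_ ?_)
        · rw [norm_mul, Real.norm_eq_abs, abs_mul, abs_mul]
          refine mul_le_mul_of_nonneg_right ?_ (norm_nonneg _)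
          exact (mul_le_of_le_one_right (by positivity) (Real.abs_sin_le_one _)).trans
            ((mul_le_of_le_one_right (abs_nonneg _) (Real.abs_sinc_le_one _)).trans h3)
        · rw [norm_mul, Real.norm_eq_abs, Real.norm_eq_abs, abs_sub_comm,
            abs_of_nonneg (sq_nonneg (Real.sin _))]
          exact mul_le_of_le_one_right (abs_nonneg _) (Real.sin_sq_le_one _))
      a ⟨ha, le_rfl⟩
    rwa [sub_zero, ← dist_eq_norm, dist_comm] at this
  have hlim : Filter.Tendsto (fun E' => gronwallBound 0 (|E| + M + 1) |E' - E| a) (𝓝 E)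
      (𝓝 0) := by
    have hc : Continuous fun E' => gronwallBound 0 (|E| + M + 1) |E' - E| a :=
      (gronwallBound_continuous_ε 0 (|E| + M + 1) a).comp (by fun_prop)
    simpa [gronwallBound_ε0_δ0] using hc.tendsto E
  exact tendsto_iff_dist_tendsto_zero.2
    (squeeze_zero (fun _ => dist_nonneg) bound hlim)

/-- The Prüfer amplitude belonging to a Prüfer angle. -/
theorem exists_amplitude (hVc : Continuous V) (h : IsPruferAngle V E θ) :
    ∃ R : ℝ → ℝ, R 0 = 1 ∧ (∀ x, 0 < R x) ∧
      ∀ x, HasDerivAt R ((1 + V x - E) * Real.sin (θ x) * Real.cos (θ x) * R x) x := by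
  have hθ := h.continuous
  have hq : Continuous fun x => (1 + V x - E) * Real.sin (θ x) * Real.cos (θ x) := by fun_prop
  refine ⟨fun x => Real.exp (∫ t in (0 : ℝ)..x,
    (1 + V t - E) * Real.sin (θ t) * Real.cos (θ t)), by simp, fun x => Real.exp_pos _,
    fun x => ?_⟩
  exact (hq.integral_hasStrictDerivAt 0 x).hasDerivAt.exp.congr_deriv (mul_comm _ _)

/-- Polar coordinates turn a Prüfer angle into a solution of the Schrödinger equation. -/
theorem hasDerivAt_solution (h : IsPruferAngle V E θ) {R : ℝ → ℝ}
    (hR : ∀ x, HasDerivAt R ((1 + V x - E) * Real.sin (θ x) * Real.cos (θ x) * R x) x) (x : ℝ) :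
    HasDerivAt (fun t => R t * Real.sin (θ t)) (R x * Real.cos (θ x)) x ∧
      HasDerivAt (fun t => R t * Real.cos (θ t)) ((V x - E) * (R x * Real.sin (θ x))) x := by
  have hsc := Real.sin_sq_add_cos_sq (θ x)
  constructor
  · refine ((hR x).mul (h.hasDerivAt x).sin).congr_deriv ?_
    ring
  · refine ((hR x).mul (h.hasDerivAt x).cos).congr_deriv ?_
    linear_combination (1 + V x - E) * R x * Real.sin (θ x) * hsc

/-- A solution on `[0, a]` vanishing at `0` is a multiple of the one given by the Prüfer angle. -/
theorem exists_eq_mul (h : IsPruferAngle V E θ) {R w : ℝ → ℝ} {a : ℝ}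
    (hR0 : R 0 = 1) (hRpos : ∀ x, 0 < R x)
    (hR : ∀ x, HasDerivAt R ((1 + V x - E) * Real.sin (θ x) * Real.cos (θ x) * R x) x)
    (hw : ContDiff ℝ 2 w) (hode : ∀ x ∈ Icc 0 a, deriv (deriv w) x = (V x - E) * w x)
    (hw0 : w 0 = 0) : ∀ x ∈ Icc 0 a, w x = deriv w 0 * (R x * Real.sin (θ x)) := by
  have hw1 (x : ℝ) : HasDerivAt w (deriv w x) x :=
    (hw.differentiable (by norm_num) x).hasDerivAt
  have hw2 (x : ℝ) (hx : x ∈ Icc 0 a) : HasDerivAt (deriv w) ((V x - E) * w x) x := by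
    rw [← hode x hx]
    exact (hw.differentiable_deriv_two x).hasDerivAt
  have wronskian_zero : ∀ x ∈ Icc 0 a,
      w x * (R x * Real.cos (θ x)) - deriv w x * (R x * Real.sin (θ x)) = 0 := by
    have hW (x : ℝ) (hx : x ∈ Icc 0 a) : HasDerivAt
        (fun t => w t * (R t * Real.cos (θ t)) - deriv w t * (R t * Real.sin (θ t))) 0 x := by
      obtain ⟨hs, hc⟩ := h.hasDerivAt_solution hR x
      refine (((hw1 x).mul hc).sub ((hw2 x hx).mul hs)).congr_deriv ?_
      ring
    intro x hx
    rw [constant_of_has_deriv_right_zero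
      (fun t ht => (hW t ht).continuousAt.continuousWithinAt)
      (fun t ht => (hW t (Ico_subset_Icc_self ht)).hasDerivWithinAt) x hx]
    simp [hw0, h.map_zero]
  have wronskian_angle (x : ℝ) (hx : x ∈ Icc 0 a) :
      w x * Real.cos (θ x) = deriv w x * Real.sin (θ x) := by
    have := wronskian_zero x hx
    have hz : R x * (w x * Real.cos (θ x) - deriv w x * Real.sin (θ x)) = 0 := by
      linear_combination this
    exact sub_eq_zero.1 ((mul_eq_zero.1 hz).resolve_left (hRpos x).ne')
  have ratio : ∀ x ∈ Icc 0 a,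
      (w x * Real.sin (θ x) + deriv w x * Real.cos (θ x)) / R x = deriv w 0 := by
    have hd (x : ℝ) (hx : x ∈ Icc 0 a) : HasDerivAt
        (fun t => (w t * Real.sin (θ t) + deriv w t * Real.cos (θ t)) / R t) 0 x := by
      have hθ := h.hasDerivAt x
      refine ((((hw1 x).mul hθ.sin).add ((hw2 x hx).mul hθ.cos)).div (hR x)
        (hRpos x).ne').congr_deriv ?_
      have hwr := wronskian_angle x hx
      have hsc := Real.sin_sq_add_cos_sq (θ x)
      rw [div_eq_zero_iff]
      left
      simp only [Pi.add_apply, Pi.mul_apply]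
      linear_combination R x * (1 + (E - V x - 1) * Real.sin (θ x) ^ 2 + (V x - E) -
        (1 + V x - E) * Real.sin (θ x) ^ 2) * hwr -
        R x * (1 + V x - E) * deriv w x * Real.sin (θ x) * hsc
    intro x hx
    rw [constant_of_has_deriv_right_zero
      (fun t ht => (hd t ht).continuousAt.continuousWithinAt)
      (fun t ht => (hd t (Ico_subset_Icc_self ht)).hasDerivWithinAt) x hx]
    simp [hR0, h.map_zero]
  intro x hx
  rw [← ratio x hx]
  have hRx := (hRpos x).ne'
  field_simp
  linear_combination Real.cos (θ x) * wronskian_angle x hx -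
    w x * Real.sin_sq_add_cos_sq (θ x)

/-- Dirichlet eigenvalues are the energies at which the Prüfer angle at the right endpoint is a
multiple of `π`. -/
theorem isDirichletEigenvalue_iff (hVc : Continuous V) (h : IsPruferAngle V E θ) {a : ℝ}
    (ha : 0 < a) : IsDirichletEigenvalue V a E ↔ Real.sin (θ a) = 0 := by
  obtain ⟨R, hR0, hRpos, hR⟩ := h.exists_amplitude hVc
  constructor
  · rintro ⟨w, hw, hode, ⟨x, hx, hwx⟩, hw0, hwa⟩
    have key := h.exists_eq_mul hR0 hRpos hR hw hode hw0
    have hne : deriv w 0 ≠ 0 := fun h0 => hwx (by rw [key x hx, h0, zero_mul])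
    have := key a ⟨ha.le, le_rfl⟩
    rw [hwa] at this
    simpa [hne, (hRpos a).ne'] using this
  · intro hsin
    have hs := fun x => (h.hasDerivAt_solution hR x).1
    have hc := fun x => (h.hasDerivAt_solution hR x).2
    have hds : deriv (fun t => R t * Real.sin (θ t)) = fun t => R t * Real.cos (θ t) :=
      funext fun x => (hs x).deriv
    have hdc : deriv (fun t => R t * Real.cos (θ t)) =
        fun t => (V t - E) * (R t * Real.sin (θ t)) := funext fun x => (hc x).deriv
    have hscont : Continuous fun t => R t * Real.sin (θ t) :=
      continuous_iff_continuousAt.2 fun x => (hs x).continuousAt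
    have hcsmooth : ContDiff ℝ 1 fun t => R t * Real.cos (θ t) := by
      rw [contDiff_one_iff_deriv, hdc]
      exact ⟨fun x => (hc x).differentiableAt, by fun_prop⟩
    have hssmooth : ContDiff ℝ (1 + 1) fun t => R t * Real.sin (θ t) := by
      rw [contDiff_succ_iff_deriv, hds]
      exact ⟨fun x => (hs x).differentiableAt, by simp, hcsmooth⟩
    refine ⟨fun t => R t * Real.sin (θ t), by rwa [one_add_one_eq_two] at hssmooth,
      fun x _ => by rw [hds, hdc], ?_, by simp [h.map_zero], by simp [hsin]⟩
    by_contra! hzero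
    have hd := (hs 0).hasDerivWithinAt (s := Icc 0 a)
    have h0 : HasDerivWithinAt (fun t => R t * Real.sin (θ t)) 0 (Icc 0 a) 0 :=
      (hasDerivWithinAt_const 0 (Icc 0 a) (0 : ℝ)).congr hzero (hzero 0 ⟨le_rfl, ha.le⟩)
    have := ((uniqueDiffOn_Icc ha) 0 ⟨le_rfl, ha.le⟩).eq_deriv _ hd h0
    simp [hR0, h.map_zero] at this

/-- If the Prüfer angle takes the value `mπ` at `a`, its sine has `m - 1` zeros in `(0, a)`. -/
theorem ncard_zeros (h : IsPruferAngle V E θ) {a : ℝ} (ha : 0 < a) {m : ℤ}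
    (hm : θ a = m * Real.pi) :
    {x ∈ Ioo 0 a | Real.sin (θ x) = 0}.Finite ∧
      {x ∈ Ioo 0 a | Real.sin (θ x) = 0}.ncard = (m - 1).toNat := by
  have level {x : ℝ} {k : ℤ} (hk : k * Real.pi = θ x) : ⌊θ x / Real.pi⌋ = k := by
    rw [← hk, mul_div_cancel_right₀ _ Real.pi_ne_zero, Int.floor_intCast]
  have hinj : InjOn (fun x => ⌊θ x / Real.pi⌋) {x ∈ Ioo 0 a | Real.sin (θ x) = 0} := by
    rintro x ⟨-, hx⟩ y ⟨-, hy⟩ hxy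
    obtain ⟨k, hk⟩ := Real.sin_eq_zero_iff.1 hx
    obtain ⟨l, hl⟩ := Real.sin_eq_zero_iff.1 hy
    simp only [level hk, level hl] at hxy
    subst hxy
    rcases lt_trichotomy x y with hlt | heq | hlt
    · exact absurd (h.int_mul_pi_lt k hk.le hlt) hl.not_lt
    · exact heq
    · exact absurd (h.int_mul_pi_lt k hl.le hlt) hk.not_lt
  have himage : (fun x => ⌊θ x / Real.pi⌋) '' {x ∈ Ioo 0 a | Real.sin (θ x) = 0} =
      ↑(Finset.Ioo 0 m) := by
    ext k
    rw [Finset.coe_Ioo]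
    constructor
    · rintro ⟨x, ⟨hx, hsin⟩, rfl⟩
      obtain ⟨k, hk⟩ := Real.sin_eq_zero_iff.1 hsin
      simp only [level hk]
      constructor
      · have := h.pos hx.1
        rw [← hk] at this
        exact_mod_cast pos_of_mul_pos_left this Real.pi_pos.le
      · have := h.int_mul_pi_lt k hk.le hx.2
        rw [hm] at this
        exact_mod_cast lt_of_mul_lt_mul_right this Real.pi_pos.le
    · rintro ⟨hk0, hkm⟩
      have hk0' : (0 : ℝ) < k := by exact_mod_cast hk0
      have hkm' : (k : ℝ) < m := by exact_mod_cast hkm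
      obtain ⟨x, hx, hθx⟩ := intermediate_value_Ioo ha.le h.continuous.continuousOn
        (show k * Real.pi ∈ Ioo (θ 0) (θ a) by
          rw [h.map_zero, hm]
          exact ⟨mul_pos hk0' Real.pi_pos, mul_lt_mul_of_pos_right hkm' Real.pi_pos⟩)
      exact ⟨x, ⟨hx, by rw [hθx, Real.sin_int_mul_pi]⟩, level hθx.symm⟩
  constructor
  · exact Finite.of_finite_image (himage ▸ Finset.finite_toSet _) hinj
  · rw [← hinj.ncard_image, himage, ncard_coe_finset, Int.card_Ioo]
    simp

end IsPruferAngle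

/-- If `E₀ < E₁ < ⋯ < Eₙ` are the `n+1` lowest Dirichlet eigenvalues of
`−d²/dx² + V` on `[0,a]`, then the solution `u(·,Eₙ)` with `u(0) = 0`, `u′(0) = 1` has exactly
`n` zeros in `(0,a)`. -/
theorem nth_eigenfunction_has_n_zeros (V : ℝ → ℝ) (hVb : ∃ M, ∀ x, |V x| ≤ M)
    (hVc : Continuous V) (a : ℝ) (ha : 0 < a) (n : ℕ) (E : Fin (n + 1) → ℝ)
    (hmono : StrictMono E) (hev : ∀ i, IsDirichletEigenvalue V a (E i))
    (hlowest : ∀ E' : ℝ, IsDirichletEigenvalue V a E' → E' ≤ E (Fin.last n) →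
      ∃ i, E' = E i)
    (u : ℝ → ℝ) (hu : ContDiff ℝ 2 u)
    (hode : ∀ x, deriv (deriv u) x = (V x - E (Fin.last n)) * u x)
    (h0 : u 0 = 0) (h0' : deriv u 0 = 1) :
    {x ∈ Ioo 0 a | u x = 0}.Finite ∧ {x ∈ Ioo 0 a | u x = 0}.ncard = n := by
  choose Θ hΘ using exists_isPruferAngle hVb hVc
  have hΘmono : StrictMono fun e => Θ e a :=
    fun e e' hee => (hΘ e).lt_of_lt hVc (hΘ e') hee ha
  have hlevel (i : Fin (n + 1)) : ∃ k : ℤ, k * Real.pi = Θ (E i) a :=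
    Real.sin_eq_zero_iff.1 (((hΘ (E i)).isDirichletEigenvalue_iff hVc ha).1 (hev i))
  choose k hk using hlevel
  have hkmono : StrictMono k := fun i j hij => by
    have : Θ (E i) a < Θ (E j) a := hΘmono (hmono hij)
    rw [← hk, ← hk] at this
    exact_mod_cast lt_of_mul_lt_mul_right this Real.pi_pos.le
  have hkpos (i : Fin (n + 1)) : 0 < k i := by
    have := (hΘ (E i)).pos ha
    rw [← hk] at this
    exact_mod_cast pos_of_mul_pos_left this Real.pi_pos.le
  have hattained {l : ℤ} (hl : 0 < l) (hlm : l ≤ k (Fin.last n)) : ∃ i, k i = l := by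
    obtain ⟨M, hM⟩ := hVb
    have hl' : (1 : ℝ) ≤ l := by exact_mod_cast hl
    have hlow : Θ (-M - 1) a < l * Real.pi := by
      have := (hΘ (-M - 1)).lt_pi_div_two (fun x => by linarith [neg_abs_le (V x), hM x]) ha
      nlinarith [Real.pi_pos]
    have hhigh : l * Real.pi ≤ Θ (E (Fin.last n)) a := by
      rw [← hk]
      exact mul_le_mul_of_nonneg_right (by exact_mod_cast hlm) Real.pi_pos.le
    have hle : -M - 1 ≤ E (Fin.last n) := (hΘmono.lt_iff_lt.1 (hlow.trans_le hhigh)).le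
    obtain ⟨e, he, hθe⟩ := intermediate_value_Icc hle
      (IsPruferAngle.continuous_energy ⟨M, hM⟩ hΘ ha.le).continuousOn ⟨hlow.le, hhigh⟩
    obtain ⟨i, rfl⟩ := hlowest e (((hΘ e).isDirichletEigenvalue_iff hVc ha).2
      (by simp only at hθe; rw [hθe, Real.sin_int_mul_pi])) he.2
    refine ⟨i, ?_⟩
    have := (hk i).trans hθe
    exact_mod_cast mul_right_cancel₀ Real.pi_ne_zero this
  have hcount : k (Fin.last n) = n + 1 := by
    have himage : Finset.univ.image k = Finset.Icc 1 (k (Fin.last n)) := by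
      ext l
      simp only [Finset.mem_image, Finset.mem_univ, true_and, Finset.mem_Icc]
      constructor
      · rintro ⟨i, rfl⟩
        exact ⟨hkpos i, hkmono.monotone (Fin.le_last i)⟩
      · rintro ⟨h1, h2⟩
        exact hattained h1 h2
    have hcard := congrArg Finset.card himage
    rw [Finset.card_image_of_injective _ hkmono.injective, Finset.card_fin, Int.card_Icc] at hcard
    have := hkpos (Fin.last n)
    omega
  have hangle := hΘ (E (Fin.last n))
  obtain ⟨R, hR0, hRpos, hR⟩ := hangle.exists_amplitude hVc
  have hu_eq := hangle.exists_eq_mul hR0 hRpos hR hu (fun x (_ : x ∈ Icc 0 a) => hode x) h0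
  have hzeros : {x ∈ Ioo 0 a | u x = 0} =
      {x ∈ Ioo 0 a | Real.sin (Θ (E (Fin.last n)) x) = 0} := by
    ext x
    refine and_congr_right fun hx => ?_
    rw [hu_eq x (Ioo_subset_Icc_self hx), h0', one_mul, mul_eq_zero,
      or_iff_right (hRpos x).ne']
  have hfinal := hangle.ncard_zeros ha (hk (Fin.last n)).symm
  rw [hzeros]
  refine ⟨hfinal.1, hfinal.2.trans ?_⟩
  rw [hcount]
  simp
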